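/- (Theorem 1, primal convergence of Frank–Wolfe.) For each r ≥ 1, the Frank–Wolfe iterates satisfy L(w^(r)) − L(w*) ≤ (2·C_f/(r+2))·(1 + δ). -/

import Mathlib

open scoped RealInnerProductSpace BigOperators

noncomputable section

/-- The standard simplex `D = {w ∈ ℝ^K : wᵢ ≥ 0, Σᵢ wᵢ = 1}`. -/
def simplexD (K : ℕ) : Set (EuclideanSpace ℝ (Fin K)) :=
  {w | (∀ i, 0 ≤ w i) ∧ ∑ i, w i = 1}

/-- The surrogate duality gap `φ(w) = max_{s ∈ D} ⟨w − s, ∇L(w)⟩`. -/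
def dualGap {K : ℕ} (gradL : EuclideanSpace ℝ (Fin K) → EuclideanSpace ℝ (Fin K))
    (w : EuclideanSpace ℝ (Fin K)) : ℝ :=
  sSup ((fun s => ⟪w - s, gradL w⟫) '' simplexD K)

theorem aux_grad {K : ℕ} (L : EuclideanSpace ℝ (Fin K) → ℝ)
    (x y g : EuclideanSpace ℝ (Fin K)) (hg : HasGradientAt L g x)
    (hconv : ConvexOn ℝ Set.univ L) : L x + ⟪y - x, g⟫ ≤ L y := by
  have h1 : ConvexOn ℝ Set.univ (L ∘ (AffineMap.lineMap x y : ℝ →ᵃ[ℝ] _)) := by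
    simpa using hconv.comp_affineMap (AffineMap.lineMap x y : ℝ →ᵃ[ℝ] _)
  have h2 : HasDerivAt (L ∘ (AffineMap.lineMap x y : ℝ →ᵃ[ℝ] _)) (⟪g, y - x⟫) (0:ℝ) := by
    have h3 : HasDerivAt (AffineMap.lineMap x y : ℝ → EuclideanSpace ℝ (Fin K)) (y - x) (0:ℝ) :=
      AffineMap.hasDerivAt_lineMap
    have h4 : HasFDerivAt L (InnerProductSpace.toDual ℝ _ g)
        ((AffineMap.lineMap x y : ℝ →ᵃ[ℝ] _) (0:ℝ)) := by
      simpa using hg.hasFDerivAt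
    simpa using h4.comp_hasDerivAt (0:ℝ) h3
  have h5 := h1.le_slope_of_hasDerivAt (Set.mem_univ (0:ℝ)) (Set.mem_univ (1:ℝ)) one_pos h2
  simp [slope_def_field] at h5
  rw [real_inner_comm]
  linarith

theorem aux_bdd {K : ℕ} (g : EuclideanSpace ℝ (Fin K)) :
    BddBelow ((fun t => ⟪t, g⟫) '' simplexD K) := by
  refine ⟨-∑ i, |g i|, ?_⟩
  rintro _ ⟨t, ⟨h0, h1⟩, rfl⟩
  simp only [PiLp.inner_apply]
  rw [← Finset.sum_neg_distrib]
  refine Finset.sum_le_sum fun i _ => ?_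
  have hi : t i ≤ 1 := by
    rw [← h1]
    exact Finset.single_le_sum (f := fun i => t i) (fun j _ => h0 j) (Finset.mem_univ i)
  have := h0 i
  simp only [RCLike.inner_apply, conj_trivial]
  have h2 := neg_abs_le (g i)
  have h3 := abs_nonneg (g i)
  nlinarith

theorem aux_step {K : ℕ} {a b : EuclideanSpace ℝ (Fin K)} (ha : a ∈ simplexD K)
    (hb : b ∈ simplexD K) {γ : ℝ} (h0 : 0 ≤ γ) (h1 : γ ≤ 1) :
    a + γ • (b - a) ∈ simplexD K := by
  constructor
  · intro i
    have := ha.1 i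
    have := hb.1 i
    simp only [PiLp.add_apply, PiLp.smul_apply, PiLp.sub_apply, smul_eq_mul]
    nlinarith
  · simp only [PiLp.add_apply, PiLp.smul_apply, PiLp.sub_apply, smul_eq_mul]
    rw [Finset.sum_add_distrib, ← Finset.mul_sum, Finset.sum_sub_distrib, ha.2, hb.2]
    ring

theorem stmt4 {K : ℕ} (hK : 1 ≤ K)
    (L : EuclideanSpace ℝ (Fin K) → ℝ)
    (gradL : EuclideanSpace ℝ (Fin K) → EuclideanSpace ℝ (Fin K))
    (hgrad : ∀ x, HasGradientAt L (gradL x) x)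
    (hconv : ConvexOn ℝ Set.univ L)
    (Cf : ℝ) (hCf : 0 ≤ Cf)
    (hcurv : ∀ w ∈ simplexD K, ∀ s ∈ simplexD K, ∀ γ ∈ Set.Icc (0:ℝ) 1,
      L (w + γ • (s - w)) ≤ L w + γ * ⟪s - w, gradL w⟫ + γ ^ 2 / 2 * Cf)
    (wstar : EuclideanSpace ℝ (Fin K)) (hwstar : wstar ∈ simplexD K)
    (hmin : ∀ v ∈ simplexD K, L wstar ≤ L v)
    (δ : ℝ) (hδ : 0 ≤ δ)
    (w s : ℕ → EuclideanSpace ℝ (Fin K))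
    (hw0 : w 0 ∈ simplexD K)
    (hsmem : ∀ r : ℕ, s r ∈ simplexD K)
    (hstep : ∀ r : ℕ, w (r + 1) = w r + (2 / ((r : ℝ) + 2)) • (s r - w r))
    (happrox : ∀ r : ℕ, ⟪s r, gradL (w r)⟫ ≤
      sInf ((fun t => ⟪t, gradL (w r)⟫) '' simplexD K) + 1 / 2 * δ * (2 / ((r : ℝ) + 2)) * Cf)
    :
    ∀ r : ℕ, 1 ≤ r → L (w r) - L wstar ≤ 2 * Cf / ((r : ℝ) + 2) * (1 + δ) := by
  have hγ : ∀ r : ℕ, 0 ≤ 2 / ((r : ℝ) + 2) ∧ 2 / ((r : ℝ) + 2) ≤ 1 := fun r => by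
    have : (0:ℝ) ≤ r := Nat.cast_nonneg r
    exact ⟨by positivity, by rw [div_le_one (by positivity)]; linarith⟩
  have hmem : ∀ r, w r ∈ simplexD K := by
    intro r
    induction r with
    | zero => exact hw0
    | succ n ih =>
      rw [hstep]
      exact aux_step ih (hsmem n) (hγ n).1 (hγ n).2
  have hrec : ∀ r : ℕ, L (w (r + 1)) - L wstar ≤ (1 - 2 / ((r : ℝ) + 2)) * (L (w r) - L wstar)
      + (2 / ((r : ℝ) + 2)) ^ 2 * (Cf * (1 + δ) / 2) := by
    intro r
    have h1 := hcurv _ (hmem r) _ (hsmem r) _ (hγ r)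
    rw [← hstep] at h1
    have h2 := happrox r
    have h3 : sInf ((fun t => ⟪t, gradL (w r)⟫) '' simplexD K) ≤ ⟪wstar, gradL (w r)⟫ :=
      csInf_le (aux_bdd _) ⟨wstar, hwstar, rfl⟩
    have h4 := aux_grad L (w r) wstar _ (hgrad (w r)) hconv
    rw [inner_sub_left] at h1 h4
    obtain ⟨h5, -⟩ := hγ r
    generalize 2 / ((r : ℝ) + 2) = γ at *
    have h6 : ⟪s r, gradL (w r)⟫ - ⟪w r, gradL (w r)⟫ ≤
      L wstar - L (w r) + 1 / 2 * δ * γ * Cf := by linarith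
    have h7 := mul_le_mul_of_nonneg_left h6 h5
    linarith
  intro r hr
  induction r, hr using Nat.le_induction with
  | base =>
    have h := hrec 0
    have : 0 ≤ Cf * (1 + δ) := by positivity
    norm_num at h ⊢
    linarith
  | succ n hn ih =>
    have h := hrec n
    have hn0 : (0:ℝ) ≤ n := Nat.cast_nonneg n
    have hC : 0 ≤ Cf * (1 + δ) := by positivity
    have h1 := mul_le_mul_of_nonneg_left ih (sub_nonneg.2 (hγ n).2)
    refine (h.trans (add_le_add_left h1 _)).trans ?_
    push_cast
    have e : 2 * Cf / ((n : ℝ) + 1 + 2) * (1 + δ) - ((1 - 2 / ((n : ℝ) + 2)) *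
        (2 * Cf / ((n : ℝ) + 2) * (1 + δ)) + (2 / ((n : ℝ) + 2)) ^ 2 * (Cf * (1 + δ) / 2))
        = 2 * (Cf * (1 + δ)) / (((n : ℝ) + 1 + 2) * ((n : ℝ) + 2) ^ 2) := by
      field_simp
      ring
    have : 0 ≤ 2 * (Cf * (1 + δ)) / (((n : ℝ) + 1 + 2) * ((n : ℝ) + 2) ^ 2) := by positivity
    linarith
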